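/- arXiv:1509.05759 — 3 statements merged into one kernel-verified Lean document; each statement's English description precedes it below -/
import Mathlib

section
/- Let X ⊆ ℝ^d be open and nonempty and Y ⊆ ℝ^d be compact. Then V(X,Y) is compact. -/
/-- For `X, Y ⊆ ℝ^d`, `V(X,Y) = {η : ∀ x ∈ X, η * x ∈ Y}` (coordinatewise product). -/
def Vset {d : ℕ} (X Y : Set (Fin d → ℝ)) : Set (Fin d → ℝ) :=
  {η | ∀ x ∈ X, η * x ∈ Y}

/-- `V(X,Y)` is closed when `Y` is closed. -/
theorem isClosed_Vset {d : ℕ} (X : Set (Fin d → ℝ)) {Y : Set (Fin d → ℝ)} (hY : IsClosed Y) :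
    IsClosed (Vset X Y) := by
  simp only [Vset, Set.ofPred_forall]
  exact isClosed_biInter fun x _ => hY.preimage (continuous_mul_const x)

/-- A nonempty open subset of `ℝ^d` contains a point with no zero coordinate. -/
theorem IsOpen.exists_mem_forall_ne_zero {d : ℕ} {X : Set (Fin d → ℝ)} (hX : IsOpen X)
    (hXne : X.Nonempty) : ∃ x ∈ X, ∀ i, x i ≠ 0 := by
  have hdense : Dense (Set.univ.pi fun _ : Fin d => ({0}ᶜ : Set ℝ)) :=
    dense_pi Set.univ fun _ _ => dense_compl_singleton 0
  obtain ⟨x, hxX, hx⟩ := hdense.inter_open_nonempty X hX hXne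
  exact ⟨x, hxX, fun i => hx i (Set.mem_univ i)⟩

/-- If `X ⊆ ℝ^d` is open and nonempty and `Y ⊆ ℝ^d` is compact, then `V(X,Y)` is compact. -/
theorem stmt1 {d : ℕ} (hd : 0 < d) (X Y : Set (Fin d → ℝ))
    (hX : IsOpen X) (hXne : X.Nonempty) (hY : IsCompact Y) :
    IsCompact (Vset X Y) := by
  obtain ⟨x, hxX, hx⟩ := hX.exists_mem_forall_ne_zero hXne
  refine (hY.image (continuous_mul_const x⁻¹)).of_isClosed_subset
    (isClosed_Vset X hY.isClosed) fun η hη => ⟨η * x, hη x hxX, ?_⟩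
  ext i
  simp [hx i]
end

section
/- Equip ℝ^d with the sup-norm distance. Let Ω ⊆ ℝ^d be open, let η ∈ ℝ^d satisfy η*x ∈ Ω for all x ∈ Ω (i.e. η ∈ V(Ω)) and η_j ≠ 0 for all j. Then for every x ∈ Ω, the distance from η*x to the complement of Ω satisfies infDist(η*x, Ωᶜ) ≥ (min_j |η_j|) · infDist(x, Ωᶜ). -/
/-- Coordinatewise multiplication by `η` expands the sup norm by at least `min_j |η j|`. -/
theorem iInf_abs_mul_norm_le_norm_mul {ι : Type*} [Fintype ι] (η v : ι → ℝ) :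
    (⨅ j, |η j|) * ‖v‖ ≤ ‖η * v‖ := by
  have hm : 0 ≤ ⨅ j, |η j| := Real.iInf_nonneg fun j => abs_nonneg (η j)
  rw [← abs_of_nonneg hm, ← Real.norm_eq_abs, ← norm_smul, pi_norm_le_iff_of_nonneg (norm_nonneg _)]
  intro i
  refine le_trans ?_ (norm_le_pi_norm (η * v) i)
  rw [Pi.smul_apply, norm_smul, Pi.mul_apply, norm_mul, Real.norm_of_nonneg hm]
  exact mul_le_mul_of_nonneg_right (ciInf_le (Set.finite_range _).bddBelow i) (norm_nonneg _)

/-- Let `Ω ⊆ ℝ^d` (with the sup norm) be open and let `η ∈ V(Ω)` have all coordinates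
nonzero. Then for every `x ∈ Ω`, `infDist (η * x) Ωᶜ ≥ (min_j |η j|) * infDist x Ωᶜ`. -/
theorem stmt5 {d : ℕ} (hd : 0 < d) (Ω : Set (Fin d → ℝ)) (hΩ : IsOpen Ω)
    (η : Fin d → ℝ) (hη : ∀ x ∈ Ω, η * x ∈ Ω) (hη0 : ∀ j, η j ≠ 0) :
    ∀ x ∈ Ω,
      (⨅ j, |η j|) * Metric.infDist x Ωᶜ ≤ Metric.infDist (η * x) Ωᶜ := by
  intro x _
  rcases Ωᶜ.eq_empty_or_nonempty with h | h
  · simp [h]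
  · refine (Metric.le_infDist h).2 fun z hz => ?_
    have hzη : η * (η⁻¹ * z) = z := by
      ext j
      simp [hη0 j]
    have hy : η⁻¹ * z ∈ Ωᶜ := fun hy => hz (hzη ▸ hη _ hy)
    calc (⨅ j, |η j|) * Metric.infDist x Ωᶜ
        ≤ (⨅ j, |η j|) * dist x (η⁻¹ * z) :=
          mul_le_mul_of_nonneg_left (Metric.infDist_le_dist_of_mem hy)
            (Real.iInf_nonneg fun j => abs_nonneg (η j))
      _ ≤ dist (η * x) z := by
          have key := iInf_abs_mul_norm_le_norm_mul η (x - η⁻¹ * z)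
          rwa [mul_sub, hzη, ← dist_eq_norm, ← dist_eq_norm] at key
end

section
/- Let Ω ⊆ ℝ be open. Then V(Ω) = {η ∈ ℝ : η·x ∈ Ω for all x ∈ Ω}, equipped with the subspace topology of ℝ, is locally compact and σ-compact. -/
open Set in
/-- The multipliers of an open set `Ω ⊆ ℝ`, together with `0`, form a closed set. -/
theorem isClosed_insert_zero_multipliers {Ω : Set ℝ} (hΩ : IsOpen Ω) :
    IsClosed (insert 0 {η : ℝ | ∀ x ∈ Ω, η * x ∈ Ω}) := by
  have hcompl : (insert 0 {η : ℝ | ∀ x ∈ Ω, η * x ∈ Ω})ᶜ =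
      ⋃ c ∈ Ωᶜ, ({0}ᶜ ∩ (fun η : ℝ => η⁻¹ * c) ⁻¹' Ω) := by
    ext η
    simp only [mem_compl_iff, mem_insert_iff, mem_ofPred_eq, not_or, not_forall, mem_iUnion,
      mem_inter_iff, mem_singleton_iff, mem_preimage, exists_prop]
    constructor
    · rintro ⟨h0, x, hx, hηx⟩
      exact ⟨η * x, hηx, h0, by rwa [inv_mul_cancel_left₀ h0]⟩
    · rintro ⟨c, hc, h0, hηc⟩
      exact ⟨h0, η⁻¹ * c, hηc, by rwa [mul_inv_cancel_left₀ h0]⟩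
  rw [← isOpen_compl_iff, hcompl]
  refine isOpen_biUnion fun c _ => ContinuousOn.isOpen_inter_preimage ?_ isOpen_compl_singleton hΩ
  exact continuousOn_inv₀.mul continuousOn_const

/-- The multipliers of an open set `Ω ⊆ ℝ` form a locally closed set. -/
theorem isLocallyClosed_multipliers {Ω : Set ℝ} (hΩ : IsOpen Ω) :
    IsLocallyClosed {η : ℝ | ∀ x ∈ Ω, η * x ∈ Ω} := by
  have hclosed := isClosed_insert_zero_multipliers hΩ
  by_cases h0 : (0 : ℝ) ∈ {η : ℝ | ∀ x ∈ Ω, η * x ∈ Ω}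
  · rw [Set.insert_eq_of_mem h0] at hclosed
    exact hclosed.isLocallyClosed
  · rw [← Set.insert_sdiff_self_of_notMem h0, Set.sdiff_eq]
    exact hclosed.isLocallyClosed.inter isOpen_compl_singleton.isLocallyClosed

/-- For an open set `Ω ⊆ ℝ`, the set `V(Ω) = {η : ∀ x ∈ Ω, η * x ∈ Ω}` with the
subspace topology is locally compact and σ-compact. -/
theorem stmt8 (Ω : Set ℝ) (hΩ : IsOpen Ω) :
    LocallyCompactSpace {η : ℝ | ∀ x ∈ Ω, η * x ∈ Ω} ∧
    SigmaCompactSpace {η : ℝ | ∀ x ∈ Ω, η * x ∈ Ω} := by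
  have hloc : LocallyCompactSpace {η : ℝ | ∀ x ∈ Ω, η * x ∈ Ω} :=
    (isLocallyClosed_multipliers hΩ).locallyCompactSpace
  exact ⟨hloc, inferInstance⟩
end
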